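/- (L^q Strichartz estimate in adapted atomic spaces, Corollary 5.4 (i) and (iii).) For every T > 0 and every 2 ≤ q ≤ 4 there exists a constant C(T, q) > 0 such that for every N ≥ 1, every sign σ ∈ {+1, −1}, and every frequency-localized space-time function u_N at scale N, ‖u_N‖_{L^q([0,T] × T³)} ≤ C(T, q) N^{(q−2)/q} ‖u_N‖_{U^q_σ}. -/

import Mathlib

open MeasureTheory Filter
open scoped ENNReal Classical

section UpVp
variable {B : Type*} [NormedAddCommGroup B] [NormedSpace ℂ B]

/-- Extension of a function on `ℝ` to `EReal`, with value `0` at `∞`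
(the convention `v(∞) = 0`). -/
noncomputable def extEReal (v : ℝ → B) : EReal → B :=
  fun x => if x = ⊤ then 0 else if x = ⊥ then 0 else v x.toReal

/-- A `U^p` atom: a step function `a(s) = ∑_{k=1}^{K} 1_{[t_{k-1}, t_k)}(s) φ_{k-1}`
associated with a partition `-∞ < t₀ < t₁ < ⋯ < t_K ≤ ∞` and values
`φ₀, …, φ_{K-1} ∈ B` with `∑_{k} ‖φ_k‖^p = 1`. -/
noncomputable def IsUpAtom (p : ℝ) (a : ℝ → B) : Prop :=
  ∃ (K : ℕ) (t : Fin (K + 1) → EReal) (φ : Fin K → B),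
    StrictMono t ∧ (∀ i, t i ≠ ⊥) ∧ (∑ k, ‖φ k‖ ^ p) = 1 ∧
    ∀ s : ℝ, a s =
      ∑ k : Fin K, if t k.castSucc ≤ (s : EReal) ∧ (s : EReal) < t k.succ then φ k else 0

/-- The `U^p` (atomic space) norm of `u : ℝ → B`: the infimum of `∑_j |λ_j|` over all
representations `u = ∑_j λ_j a_j` (pointwise) with `(λ_j) ∈ ℓ¹(ℂ)` and `U^p` atoms `a_j`;
it equals `∞` when no such representation exists. -/
noncomputable def UpNorm (p : ℝ) (u : ℝ → B) : ℝ≥0∞ :=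
  sInf { M : ℝ≥0∞ | ∃ (lam : ℕ → ℂ) (a : ℕ → ℝ → B),
    (∀ j, IsUpAtom p (a j)) ∧ Summable (fun j => ‖lam j‖) ∧
    (∀ s : ℝ, HasSum (fun j => lam j • a j s) (u s)) ∧
    M = ENNReal.ofReal (∑' j, ‖lam j‖) }

/-- The `V^p` variation norm of `v : ℝ → B`: the supremum over partitions
`-∞ < t₀ < t₁ < ⋯ < t_K ≤ ∞` of `(∑_{i=1}^K ‖v(t_i) - v(t_{i-1})‖^p)^{1/p}`,
with the convention `v(∞) = 0`. -/
noncomputable def VpNorm (p : ℝ) (v : ℝ → B) : ℝ≥0∞ :=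
  ⨆ (K : ℕ) (t : Fin (K + 1) → EReal) (_ : StrictMono t) (_ : ∀ i, t i ≠ ⊥),
    ENNReal.ofReal
      ((∑ i : Fin K, ‖extEReal v (t i.succ) - extEReal v (t i.castSucc)‖ ^ p) ^ (1 / p))

end UpVp

/-- The torus `T³`, realized as the cube `[0, 2π)³` in `ℝ³` (with Lebesgue measure). -/
noncomputable def cube : Set (Fin 3 → ℝ) := Set.univ.pi fun _ => Set.Ico (0:ℝ) (2 * Real.pi)

/-- The Euclidean norm `|n|` of a lattice point `n ∈ ℤ³`. -/
noncomputable def normZ (n : Fin 3 → ℤ) : ℝ := Real.sqrt (∑ i, ((n i : ℝ)) ^ 2)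

/-- The Japanese bracket `⟨n⟩ = (1 + |n|²)^{1/2}` of a lattice point `n ∈ ℤ³`. -/
noncomputable def jbZ (n : Fin 3 → ℤ) : ℝ := Real.sqrt (1 + ∑ i, ((n i : ℝ)) ^ 2)

/-- The Euclidean inner product `n·x` for `n ∈ ℤ³`, `x ∈ ℝ³`. -/
noncomputable def dotZ (n : Fin 3 → ℤ) (x : Fin 3 → ℝ) : ℝ := ∑ i, (n i : ℝ) * x i

/-- The dyadic annulus `S_N = {n ∈ ℤ³ : N ≤ |n| < 2N}`, as a finite set of lattice points. -/
noncomputable def annulus (N : ℝ) : Finset (Fin 3 → ℤ) :=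
  (Finset.Icc (fun _ => -⌈2 * N⌉) fun _ => ⌈2 * N⌉).filter fun n =>
    N ≤ normZ n ∧ normZ n < 2 * N

/-- The space-time function `u(t,x) = ∑_{n ∈ S} c_n(t) e^{i n·x}` with frequencies in the
finite set `S ⊂ ℤ³`. -/
noncomputable def freqLocFun (S : Finset (Fin 3 → ℤ)) (c : (Fin 3 → ℤ) → ℝ → ℂ)
    (t : ℝ) (x : Fin 3 → ℝ) : ℂ :=
  ∑ n ∈ S, c n t * Complex.exp (Complex.I * ((dotZ n x : ℝ) : ℂ))

/-- The modulated coefficient curve `t ↦ (e^{-iσt⟨n⟩} c_n(t))_{n ∈ S}`, valued in `ℓ²(S)`.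
The adapted norm `‖u‖_{U^p_σ}` (resp. `‖u‖_{V^p_σ}`) of the frequency-localized function with
coefficients `c` is `UpNorm p (modCurve S σ c)` (resp. `VpNorm p (modCurve S σ c)`). -/
noncomputable def modCurve (S : Finset (Fin 3 → ℤ)) (σ : ℝ) (c : (Fin 3 → ℤ) → ℝ → ℂ) :
    ℝ → EuclideanSpace ℂ ↥S :=
  fun t => (WithLp.equiv 2 (↥S → ℂ)).symm
    fun n => Complex.exp (-(Complex.I * ((σ * jbZ (n : Fin 3 → ℤ) * t : ℝ) : ℂ))) *
      c (n : Fin 3 → ℤ) t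

theorem jbZ_pos (n : Fin 3 → ℤ) : 0 < jbZ n :=
  Real.sqrt_pos.2 (by positivity)

theorem jbZ_sq (n : Fin 3 → ℤ) : jbZ n ^ 2 = 1 + ∑ i, (n i : ℝ) ^ 2 :=
  Real.sq_sqrt (by positivity)

theorem abs_coord_le_jbZ (n : Fin 3 → ℤ) (i : Fin 3) : |(n i : ℝ)| ≤ jbZ n := by
  apply Real.abs_le_sqrt
  have := Finset.single_le_sum (f := fun i => (n i : ℝ) ^ 2) (fun _ _ => sq_nonneg _)
    (Finset.mem_univ i)
  linarith

theorem normZ_sq (n : Fin 3 → ℤ) : normZ n ^ 2 = ∑ i, (n i : ℝ) ^ 2 :=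
  Real.sq_sqrt (by positivity)

theorem normZ_nonneg (n : Fin 3 → ℤ) : 0 ≤ normZ n := Real.sqrt_nonneg _

theorem jbZ_sq_eq_normZ (n : Fin 3 → ℤ) : jbZ n ^ 2 = 1 + normZ n ^ 2 := by
  rw [jbZ_sq, normZ_sq]

theorem le_jbZ_of_mem_annulus {N : ℝ} {n : Fin 3 → ℤ} (hn : n ∈ annulus N) : N ≤ jbZ n := by
  have h := (Finset.mem_filter.1 hn).2.1
  have := jbZ_sq_eq_normZ n
  nlinarith [jbZ_pos n, normZ_nonneg n]

theorem jbZ_le_of_mem_annulus {N : ℝ} (hN : 1 ≤ N) {n : Fin 3 → ℤ} (hn : n ∈ annulus N) :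
    jbZ n ≤ 3 * N := by
  have h := (Finset.mem_filter.1 hn).2.2
  have := jbZ_sq_eq_normZ n
  nlinarith [jbZ_pos n, normZ_nonneg n]

theorem abs_coord_le_of_mem_annulus {N : ℝ} {n : Fin 3 → ℤ} (hn : n ∈ annulus N) (i : Fin 3) :
    |(n i : ℝ)| ≤ 2 * N := by
  have h := (Finset.mem_filter.1 hn).2.2
  have h2 : |(n i : ℝ)| ≤ normZ n := by
    apply Real.abs_le_sqrt
    exact Finset.single_le_sum (f := fun i => (n i : ℝ) ^ 2) (fun _ _ => sq_nonneg _)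
      (Finset.mem_univ i)
  linarith

/-- The squared length of the gradient of `x ↦ ⟨x⟩ + ⟨ξ - x⟩`. -/
theorem sum_sq_phase_gradient {a b : ℝ} (ha : 0 < a) (hb : 0 < b) (x y : Fin 3 → ℝ)
    (hx : a ^ 2 = 1 + ∑ i, x i ^ 2) (hy : b ^ 2 = 1 + ∑ i, y i ^ 2) :
    ∑ i, (x i / a - y i / b) ^ 2 =
      ((a + b) ^ 2 - ∑ i, (x i + y i) ^ 2) / (a * b) - (1 / a + 1 / b) ^ 2 := by
  simp only [Fin.sum_univ_three] at *
  have h1 : x 0 ^ 2 = a ^ 2 - 1 - x 1 ^ 2 - x 2 ^ 2 := by linarith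
  have h2 : y 0 ^ 2 = b ^ 2 - 1 - y 1 ^ 2 - y 2 ^ 2 := by linarith
  field_simp
  ring_nf
  rw [h1, h2]
  ring

theorem abs_ratio_sub_le {N a a' p p' : ℝ} (hN : 0 < N) (ha : N ≤ a) (ha' : N ≤ a')
    (hp : |p| ≤ a) (hp' : |p'| ≤ a') (h : a' ^ 2 - a ^ 2 = p' ^ 2 - p ^ 2) :
    |(p + p') / (a + a') - p / a| ≤ |p' - p| / N := by
  have ha0 : 0 < a := by linarith
  have hs : 0 < a + a' := by linarith
  have h1 : |a' - a| ≤ |p' - p| := by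
    have h2 : (a' - a) * (a + a') = (p' - p) * (p + p') := by linarith
    have h3 : |a' - a| * (a + a') = |p' - p| * |p + p'| := by
      rw [← abs_mul, ← h2, abs_mul, abs_of_pos hs]
    have h4 : |p + p'| ≤ a + a' := (abs_add_le _ _).trans (by linarith)
    have h5 : |a' - a| * (a + a') ≤ |p' - p| * (a + a') := by
      rw [h3]; gcongr
    exact le_of_mul_le_mul_right h5 hs
  have e : (p + p') / (a + a') - p / a = ((p' - p) * a - p * (a' - a)) / (a * (a + a')) := by
    field_simp
    ring
  rw [e, abs_div, abs_of_pos (mul_pos ha0 hs), div_le_div_iff₀ (mul_pos ha0 hs) hN]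
  have h6 : |(p' - p) * a - p * (a' - a)| ≤ 2 * |p' - p| * a := by
    refine (abs_sub _ _).trans ?_
    rw [abs_mul, abs_mul, abs_of_pos ha0]
    have : |p| * |a' - a| ≤ a * |p' - p| := by gcongr
    linarith
  have h7 : 2 * N ≤ a + a' := by linarith
  calc _ ≤ 2 * |p' - p| * a * N := by gcongr
    _ = |p' - p| * (a * (2 * N)) := by ring
    _ ≤ _ := by gcongr

/-- Lower bound for the increment of the phase along a coordinate direction. -/
theorem le_abs_phase_increment {N a a' b b' p p' r r' : ℝ} (hN : 0 < N)
    (ha : N ≤ a) (ha' : N ≤ a') (hb : N ≤ b) (hb' : N ≤ b')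
    (hp : |p| ≤ a) (hp' : |p'| ≤ a') (hr : |r| ≤ b) (hr' : |r'| ≤ b')
    (h : a' ^ 2 - a ^ 2 = p' ^ 2 - p ^ 2) (h' : b' ^ 2 - b ^ 2 = r' ^ 2 - r ^ 2)
    (hpr : p + r = p' + r') :
    |p' - p| * (|p / a - r / b| - 2 * |p' - p| / N) ≤ |(a' + b') - (a + b)| := by
  have hs : 0 < a + a' := by linarith
  have hs' : 0 < b + b' := by linarith
  have e1 : a' - a = (p' - p) * ((p + p') / (a + a')) := by
    field_simp
    linarith
  have e2 : b' - b = -((p' - p) * ((r + r') / (b + b'))) := by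
    have : p' - p = r - r' := by linarith
    rw [this]
    field_simp
    linarith
  have e3 : (a' + b') - (a + b) =
      (p' - p) * ((p + p') / (a + a') - (r + r') / (b + b')) := by linarith
  rw [e3, abs_mul]
  gcongr
  have q1 := abs_ratio_sub_le hN ha ha' hp hp' h
  have q2 := abs_ratio_sub_le hN hb hb' hr hr' h'
  rw [show r' - r = -(p' - p) by linarith, abs_neg] at q2
  have e4 : p / a - r / b = ((p + p') / (a + a') - (r + r') / (b + b')) -
      ((p + p') / (a + a') - p / a) + ((r + r') / (b + b') - r / b) := by ring
  have : |p / a - r / b| ≤ |(p + p') / (a + a') - (r + r') / (b + b')| +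
      |(p + p') / (a + a') - p / a| + |(r + r') / (b + b') - r / b| := by
    conv_lhs => rw [e4]
    refine (abs_add_le _ _).trans ?_
    gcongr
    exact abs_sub _ _
  have : 2 * |p' - p| / N = |p' - p| / N + |p' - p| / N := by ring
  linarith

theorem card_le_of_forall_abs_sub_le (s : Finset ℤ) {L : ℝ} (hL : 0 ≤ L)
    (h : ∀ x ∈ s, ∀ y ∈ s, |(x : ℝ) - y| ≤ L) : s.card ≤ ⌊L⌋₊ + 1 := by
  rcases s.eq_empty_or_nonempty with rfl | hs
  · simp
  have hsub : s ⊆ Finset.Icc (s.min' hs) (s.min' hs + ⌊L⌋₊) := by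
    intro x hx
    rw [Finset.mem_Icc]
    refine ⟨s.min'_le x hx, ?_⟩
    have h1 := (le_abs_self _).trans (h x hx _ (s.min'_mem hs))
    have h2 : (x - s.min' hs) ≤ ⌊L⌋ := Int.le_floor.2 (by push_cast; exact h1)
    rw [← Int.natCast_floor_eq_floor hL] at h2
    linarith
  refine (Finset.card_le_card hsub).trans ?_
  rw [Int.card_Icc]
  omega

theorem card_le_of_coord_diam {α : Type*} (X : Finset α) (f g h : α → ℤ)
    {L M : ℝ} (hL : 0 ≤ L) (hM : 0 ≤ M)
    (hinj : ∀ x ∈ X, ∀ y ∈ X, f x = f y → g x = g y → h x = h y → x = y)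
    (hf : ∀ x ∈ X, ∀ y ∈ X, |(f x : ℝ) - f y| ≤ L)
    (hg : ∀ x ∈ X, ∀ y ∈ X, |(g x : ℝ) - g y| ≤ L)
    (hh : ∀ x ∈ X, ∀ y ∈ X, f x = f y → g x = g y → |(h x : ℝ) - h y| ≤ M) :
    X.card ≤ (⌊M⌋₊ + 1) * (⌊L⌋₊ + 1) * (⌊L⌋₊ + 1) := by
  refine (Finset.card_le_mul_card_image (f := f) X ((⌊M⌋₊ + 1) * (⌊L⌋₊ + 1)) ?_).trans
    (Nat.mul_le_mul_left _ (card_le_of_forall_abs_sub_le _ hL ?_))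
  · intro u _
    refine (Finset.card_le_mul_card_image (f := g) _ (⌊M⌋₊ + 1) ?_).trans
      (Nat.mul_le_mul_left _ (card_le_of_forall_abs_sub_le _ hL ?_))
    · intro v _
      rw [← Finset.card_image_of_injOn (f := h)]
      · apply card_le_of_forall_abs_sub_le _ hM
        simp only [Finset.mem_image, Finset.mem_filter]
        rintro _ ⟨x, ⟨⟨hx, rfl⟩, rfl⟩, rfl⟩ _ ⟨y, ⟨⟨hy, hy1⟩, hy2⟩, rfl⟩
        exact hh x hx y hy hy1.symm hy2.symm
      · intro x hx y hy hxy
        simp only [Finset.coe_filter, Finset.mem_filter, Set.mem_ofPred_eq] at hx hy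
        exact hinj x hx.1.1 y hy.1.1 (hx.1.2.trans hy.1.2.symm) (hx.2.trans hy.2.symm) hxy
    · simp only [Finset.mem_image, Finset.mem_filter]
      rintro _ ⟨x, ⟨hx, -⟩, rfl⟩ _ ⟨y, ⟨hy, -⟩, rfl⟩
      exact hg x hx y hy
  · simp only [Finset.mem_image]
    rintro _ ⟨x, hx, rfl⟩ _ ⟨y, hy, rfl⟩
    exact hf x hx y hy

theorem sum_sq_phase_gradient_bounds {N τ δ : ℝ} (hN : 1 ≤ N) {n m : Fin 3 → ℤ}
    (hn : n ∈ annulus N) (hm : m ∈ annulus N) (hτ : |jbZ n + jbZ m - τ| ≤ 1) (hτN : τ ≤ 6 * N)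
    (hδ : δ ^ 2 * N ^ 2 = τ ^ 2 - ∑ i, ((n i : ℝ) + m i) ^ 2 + 12 * N) :
    ∑ i, ((n i : ℝ) / jbZ n - m i / jbZ m) ^ 2 ≤ δ ^ 2 ∧
      (68 * N ≤ τ ^ 2 - ∑ i, ((n i : ℝ) + m i) ^ 2 →
        δ ^ 2 / 36 ≤ ∑ i, ((n i : ℝ) / jbZ n - m i / jbZ m) ^ 2) := by
  rw [sum_sq_phase_gradient (jbZ_pos n) (jbZ_pos m) _ _ (jbZ_sq n) (jbZ_sq m)]
  have ha := le_jbZ_of_mem_annulus hn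
  have hb := le_jbZ_of_mem_annulus hm
  have ha' := jbZ_le_of_mem_annulus hN hn
  have hb' := jbZ_le_of_mem_annulus hN hm
  set a := jbZ n
  set b := jbZ m
  set X := ∑ i, ((n i : ℝ) + m i) ^ 2
  obtain ⟨h1, h2⟩ := abs_le.1 hτ
  have hab : N ^ 2 ≤ a * b := by nlinarith
  have hab' : a * b ≤ 9 * N ^ 2 := by nlinarith
  have hab0 : 0 < a * b := by nlinarith
  have hN2 : 0 < N ^ 2 := by positivity
  have hup : (a + b) ^ 2 ≤ τ ^ 2 + 12 * N := by nlinarith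
  have hlo : τ ^ 2 - 12 * N ≤ (a + b) ^ 2 := by nlinarith
  constructor
  · have : ((a + b) ^ 2 - X) / (a * b) ≤ δ ^ 2 := by
      rw [div_le_iff₀ hab0]
      nlinarith [sq_nonneg δ]
    nlinarith [sq_nonneg (1 / a + 1 / b)]
  · intro h
    have h3 : 1 / a + 1 / b ≤ 2 / N := by
      have : 1 / a ≤ 1 / N := by gcongr
      have : 1 / b ≤ 1 / N := by gcongr
      have : 2 / N = 1 / N + 1 / N := by ring
      linarith
    have h4 : (1 / a + 1 / b) ^ 2 ≤ 4 / N ^ 2 := by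
      have h0 : 0 ≤ 1 / a + 1 / b := by
        have := jbZ_pos n
        have := jbZ_pos m
        positivity
      calc _ ≤ (2 / N) ^ 2 := by gcongr
        _ = _ := by ring
    have h5 : (τ ^ 2 - 12 * N - X) / (9 * N ^ 2) ≤ ((a + b) ^ 2 - X) / (a * b) := by
      rw [div_le_div_iff₀ (by positivity) hab0]
      have : 0 ≤ τ ^ 2 - 12 * N - X := by linarith
      nlinarith
    have h6 : δ ^ 2 / 36 + 4 / N ^ 2 ≤ (τ ^ 2 - 12 * N - X) / (9 * N ^ 2) := by
      have e : δ ^ 2 / 36 = (τ ^ 2 - X + 12 * N) / (36 * N ^ 2) := by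
        rw [← hδ]; field_simp
      rw [e, ← sub_nonneg]
      have : (τ ^ 2 - 12 * N - X) / (9 * N ^ 2) -
        ((τ ^ 2 - X + 12 * N) / (36 * N ^ 2) + 4 / N ^ 2) =
          (3 * (τ ^ 2 - X) - 60 * N - 144) / (36 * N ^ 2) := by
        field_simp; ring
      rw [this]
      apply div_nonneg _ (by positivity)
      linarith
    linarith

theorem exists_large_coord {δ : ℝ} {v : Fin 3 → ℝ} (h0 : 0 < δ)
    (h : δ ^ 2 / 36 ≤ ∑ i, v i ^ 2) : ∃ i, δ / 11 ≤ |v i| := by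
  by_contra! hc
  have : ∀ i, v i ^ 2 ≤ (δ / 11) ^ 2 := fun i => by
    rw [← sq_abs]
    have := (hc i).le
    gcongr
  rw [Fin.sum_univ_three] at h
  nlinarith [this 0, this 1, this 2, sq_pos_of_pos h0]

theorem abs_coord_sub_floor_le {N δ : ℝ} (hN : 1 ≤ N) (hδ : 0 < δ) {n m : Fin 3 → ℤ}
    (hn : n ∈ annulus N) (hm : m ∈ annulus N)
    (hv : ∑ i, ((n i : ℝ) / jbZ n - m i / jbZ m) ^ 2 ≤ δ ^ 2) (i : Fin 3) :
    |(n i : ℝ) - ⌊jbZ n / (jbZ n + jbZ m) / δ⌋ * δ * (n i + m i)| ≤ 6 * N * δ := by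
  have ha := jbZ_pos n
  have hb := jbZ_pos m
  have ha' := jbZ_le_of_mem_annulus hN hn
  have hb' := jbZ_le_of_mem_annulus hN hm
  set a := jbZ n
  set b := jbZ m
  have hvi : |(n i : ℝ) / a - m i / b| ≤ δ := by
    apply abs_le_of_sq_le_sq _ hδ.le
    exact (Finset.single_le_sum (f := fun i => ((n i : ℝ) / a - m i / b) ^ 2)
      (fun _ _ => sq_nonneg _) (Finset.mem_univ i)).trans hv
  set s := a / (a + b) with hs
  have e : (n i : ℝ) - s * (n i + m i) = a * b / (a + b) * (n i / a - m i / b) := by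
    rw [hs]; field_simp; ring
  have h1 : |(n i : ℝ) - s * (n i + m i)| ≤ 2 * N * δ := by
    rw [e, abs_mul, abs_of_pos (by positivity)]
    gcongr
    rw [div_le_iff₀ (by positivity)]
    nlinarith [sq_nonneg (a - b)]
  have h2 : |s - ⌊s / δ⌋ * δ| ≤ δ := by
    have f1 := Int.floor_le (s / δ)
    have f2 := (Int.lt_floor_add_one (s / δ)).le
    rw [le_div_iff₀ hδ] at f1
    rw [div_le_iff₀ hδ] at f2
    rw [abs_le]
    constructor <;> linarith
  have h3 : |(n i : ℝ) + m i| ≤ 4 * N := by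
    have := abs_coord_le_of_mem_annulus hn i
    have := abs_coord_le_of_mem_annulus hm i
    exact (abs_add_le _ _).trans (by linarith)
  have h4 : |(s - ⌊s / δ⌋ * δ) * (n i + m i)| ≤ δ * (4 * N) := by
    rw [abs_mul]; gcongr
  have : (n i : ℝ) - ⌊s / δ⌋ * δ * (n i + m i) =
      ((n i : ℝ) - s * (n i + m i)) + (s - ⌊s / δ⌋ * δ) * (n i + m i) := by ring
  rw [this]
  refine (abs_add_le _ _).trans ?_
  linarith

theorem abs_sub_lt_of_floor_eq {x y r : ℝ} (hr : 0 < r) (h : ⌊x / r⌋ = ⌊y / r⌋) :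
    |x - y| < r := by
  have := Int.abs_sub_lt_one_of_floor_eq_floor h
  rwa [← sub_div, abs_div, abs_of_pos hr, div_lt_one hr] at this

theorem jbZ_sq_sub_of_coord {n n' : Fin 3 → ℤ} {i : Fin 3} (h1 : n (i + 1) = n' (i + 1))
    (h2 : n (i + 2) = n' (i + 2)) :
    jbZ n' ^ 2 - jbZ n ^ 2 = (n' i : ℝ) ^ 2 - (n i : ℝ) ^ 2 := by
  rw [jbZ_sq, jbZ_sq, Fin.sum_univ_three, Fin.sum_univ_three]
  fin_cases i <;> simp at h1 h2 ⊢ <;> rw [h1, h2] <;> ring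

theorem eq_of_coord {n n' : Fin 3 → ℤ} {i : Fin 3} (h1 : n (i + 1) = n' (i + 1))
    (h2 : n (i + 2) = n' (i + 2)) (h0 : n i = n' i) : n = n' := by
  ext j
  fin_cases i <;> fin_cases j <;> simp at h0 h1 h2 ⊢ <;> assumption

/-- Two points of a phase window that differ in one coordinate direction only, along which the
phase gradient is of size `δ`, are at distance `O(1/δ)`. -/
theorem abs_coord_sub_le_of_window {N δ τ : ℝ} (hN : 1 ≤ N) (hδ : 0 < δ) {ξ n n' : Fin 3 → ℤ}
    {i : Fin 3} (hn : n ∈ annulus N) (hn' : n' ∈ annulus N)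
    (hm : ξ - n ∈ annulus N) (hm' : ξ - n' ∈ annulus N)
    (hw : τ ≤ jbZ n + jbZ (ξ - n)) (hw1 : jbZ n + jbZ (ξ - n) < τ + 1)
    (hw' : τ ≤ jbZ n' + jbZ (ξ - n')) (hw1' : jbZ n' + jbZ (ξ - n') < τ + 1)
    (h1 : n (i + 1) = n' (i + 1)) (h2 : n (i + 2) = n' (i + 2))
    (hd : |(n' i : ℝ) - n i| ≤ N * δ / 44)
    (hv : δ / 11 ≤ |(n i : ℝ) / jbZ n - ((ξ - n) i : ℤ) / jbZ (ξ - n)|) :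
    |(n' i : ℝ) - n i| ≤ 22 / δ := by
  have key := le_abs_phase_increment (by linarith : 0 < N) (le_jbZ_of_mem_annulus hn)
    (le_jbZ_of_mem_annulus hn') (le_jbZ_of_mem_annulus hm) (le_jbZ_of_mem_annulus hm')
    (abs_coord_le_jbZ n i) (abs_coord_le_jbZ n' i) (abs_coord_le_jbZ (ξ - n) i)
    (abs_coord_le_jbZ (ξ - n') i) (jbZ_sq_sub_of_coord h1 h2)
    (jbZ_sq_sub_of_coord (n := ξ - n) (n' := ξ - n') (i := i) (by simp [h1]) (by simp [h2]))
    (by simp)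
  have h3 : |jbZ n' + jbZ (ξ - n') - (jbZ n + jbZ (ξ - n))| ≤ 1 := by
    rw [abs_le]; constructor <;> linarith
  have h4 : 2 * |(n' i : ℝ) - n i| / N ≤ δ / 22 := by
    rw [div_le_iff₀ (by linarith)]
    linarith
  have h5 : |(n' i : ℝ) - n i| * (δ / 22) ≤ 1 :=
    (mul_le_mul_of_nonneg_left (by linarith) (abs_nonneg _)).trans (key.trans h3)
  rw [le_div_iff₀ hδ]
  linarith

theorem card_phase_window_le {N : ℝ} (hN : 1 ≤ N) (ξ : Fin 3 → ℤ) (τ : ℝ) :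
    (((annulus N).filter fun n => ξ - n ∈ annulus N ∧ τ ≤ jbZ n + jbZ (ξ - n) ∧
      jbZ n + jbZ (ξ - n) < τ + 1).card : ℝ) ≤ 10 ^ 12 * N ^ 2 := by
  set A := (annulus N).filter fun n => ξ - n ∈ annulus N ∧ τ ≤ jbZ n + jbZ (ξ - n) ∧
      jbZ n + jbZ (ξ - n) < τ + 1 with hA
  rcases A.eq_empty_or_nonempty with h | ⟨n₀, hn₀⟩
  · rw [h]; simp; positivity
  have mem : ∀ n ∈ A, n ∈ annulus N ∧ ξ - n ∈ annulus N ∧ τ ≤ jbZ n + jbZ (ξ - n) ∧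
      jbZ n + jbZ (ξ - n) < τ + 1 := fun n hn => by
    simpa [hA, Finset.mem_filter] using hn
  have hX : ∀ n : Fin 3 → ℤ, ∑ i, ((n i : ℝ) + ((ξ - n) i : ℤ)) ^ 2 = ∑ i, (ξ i : ℝ) ^ 2 :=
    fun n => by simp
  obtain ⟨hm1, hm2, hm3, hm4⟩ := mem n₀ hn₀
  set τ₀ := jbZ n₀ + jbZ (ξ - n₀) with hτ₀
  set D := τ₀ ^ 2 - ∑ i, (ξ i : ℝ) ^ 2 with hD
  have hN0 : 0 < N := by linarith
  have hτ₀N : τ₀ ≤ 6 * N := by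
    linarith [jbZ_le_of_mem_annulus hN hm1, jbZ_le_of_mem_annulus hN hm2]
  have hτ₀0 : 0 < τ₀ := add_pos (jbZ_pos _) (jbZ_pos _)
  have hD0 : 0 ≤ D := by
    have h := sum_sq_phase_gradient (jbZ_pos n₀) (jbZ_pos (ξ - n₀)) _ _ (jbZ_sq n₀)
      (jbZ_sq (ξ - n₀))
    rw [hX] at h
    have h1 : 0 ≤ D / (jbZ n₀ * jbZ (ξ - n₀)) := by
      have h2 : 0 ≤ ∑ i, ((n₀ i : ℝ) / jbZ n₀ - ((ξ - n₀) i : ℤ) / jbZ (ξ - n₀)) ^ 2 := by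
        positivity
      have h3 := sq_nonneg (1 / jbZ n₀ + 1 / jbZ (ξ - n₀))
      linarith
    by_contra! hneg
    have := div_neg_of_neg_of_pos hneg (mul_pos (jbZ_pos n₀) (jbZ_pos (ξ - n₀)))
    linarith
  have hDN : D ≤ 36 * N ^ 2 := by
    have : 0 ≤ ∑ i, (ξ i : ℝ) ^ 2 := by positivity
    nlinarith
  obtain ⟨δ, hδ, hδD⟩ : ∃ δ > 0, δ ^ 2 * N ^ 2 = D + 12 * N := by
    refine ⟨√(D + 12 * N) / N, by positivity, ?_⟩
    rw [div_pow, Real.sq_sqrt (by positivity)]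
    field_simp
  have hδ7 : δ ≤ 7 := by
    by_contra! hc
    have : 49 * N ^ 2 < δ ^ 2 * N ^ 2 := by gcongr; nlinarith
    nlinarith
  have hNδ : 1 ≤ N * δ := by
    by_contra! hc
    have : (N * δ) ^ 2 < 1 := by
      have : 0 < N * δ := by positivity
      nlinarith
    nlinarith
  have hbd : ∀ n ∈ A, _ := fun n hn => sum_sq_phase_gradient_bounds (δ := δ) hN (mem n hn).1
    (mem n hn).2.1 (τ := τ₀) (by
      obtain ⟨-, -, h3, h4⟩ := mem n hn
      rw [abs_le]; constructor <;> linarith) hτ₀N (by rw [hX]; exact hδD)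
  simp only [hX] at hbd
  obtain ⟨dir, hdir⟩ : ∃ dir : (Fin 3 → ℤ) → Fin 3, 68 * N ≤ D → ∀ n ∈ A,
      δ / 11 ≤ |(n (dir n) : ℝ) / jbZ n - ((ξ - n) (dir n) : ℤ) / jbZ (ξ - n)| := by
    by_cases hDbig : 68 * N ≤ D
    · have : ∀ n : Fin 3 → ℤ, ∃ i, n ∈ A →
          δ / 11 ≤ |(n i : ℝ) / jbZ n - ((ξ - n) i : ℤ) / jbZ (ξ - n)| := fun n => by
        by_cases hn : n ∈ A
        · obtain ⟨i, hi⟩ := exists_large_coord hδ ((hbd n hn).2 hDbig)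
          exact ⟨i, fun _ => hi⟩
        · exact ⟨0, fun h => absurd h hn⟩
      choose dir hdir using this
      exact ⟨dir, fun _ => hdir⟩
    · exact ⟨fun _ => 0, fun h => absurd h hDbig⟩
  set J : (Fin 3 → ℤ) → ℤ := fun n => ⌊jbZ n / (jbZ n + jbZ (ξ - n)) / δ⌋ with hJ
  set r := N * δ / 44 with hr
  have hr0 : 0 < r := by positivity
  set label : (Fin 3 → ℤ) → ℤ × (Fin 3 → ℤ) × Fin 3 := fun n =>
    (J n, fun i => ⌊((n i : ℝ) - J n * δ * ξ i) / r⌋, dir n) with hlabel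
  set Y : Finset (ℤ × (Fin 3 → ℤ) × Fin 3) := Finset.Icc 0 (⌊1 / δ⌋₊ : ℤ) ×ˢ
    Finset.Icc (fun _ => -264) (fun _ => 264) ×ˢ Finset.univ with hY
  have hmaps : ∀ n ∈ A, label n ∈ Y := by
    intro n hn
    obtain ⟨h1, h2, -, -⟩ := mem n hn
    have ha := jbZ_pos n
    have hb := jbZ_pos (ξ - n)
    simp only [hY, hlabel, Finset.mem_product, Finset.mem_Icc, Finset.mem_univ, and_true,
      Pi.le_def]
    refine ⟨⟨Int.floor_nonneg.2 (by positivity), ?_⟩, ?_⟩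
    · rw [Int.natCast_floor_eq_floor (by positivity)]
      apply Int.floor_le_floor
      gcongr
      rw [div_le_one (by positivity)]
      linarith
    · have h3 := abs_coord_sub_floor_le hN hδ h1 h2 (hbd n hn).1
      have h4 : ∀ i, |(n i : ℝ) - J n * δ * ξ i| ≤ 6 * N * δ := fun i => by
        have := h3 i
        simpa using this
      have h5 : ∀ i, |((n i : ℝ) - J n * δ * ξ i) / r| ≤ 264 := fun i => by
        rw [abs_div, abs_of_pos hr0, div_le_iff₀ hr0]
        refine (h4 i).trans (le_of_eq ?_)
        rw [hr]; ring
      refine ⟨fun i => ?_, fun i => ?_⟩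
      · rw [Int.le_floor]
        push_cast
        exact (abs_le.1 (h5 i)).1
      · have := (Int.floor_le _).trans (abs_le.1 (h5 i)).2
        exact_mod_cast this
  have hfib : ∀ b ∈ Y, (A.filter fun n => label n = b).card ≤
      (⌊22 / δ⌋₊ + 1) * (⌊r⌋₊ + 1) * (⌊r⌋₊ + 1) := by
    rintro ⟨j, l, i⟩ -
    have hcl : ∀ n n', label n = (j, l, i) → label n' = (j, l, i) → ∀ k,
        |(n k : ℝ) - n' k| ≤ r := by
      intro n n' h h' k
      simp only [hlabel, Prod.mk.injEq] at h h'
      have e1 := congrFun h.2.1 k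
      have e2 := congrFun h'.2.1 k
      simp only [h.1] at e1
      simp only [h'.1] at e2
      have := abs_sub_lt_of_floor_eq hr0 (e1.trans e2.symm)
      rw [sub_sub_sub_cancel_right] at this
      exact this.le
    apply card_le_of_coord_diam _ (fun n => n (i + 1)) (fun n => n (i + 2)) (fun n => n i)
      hr0.le (by positivity)
    · intro n _ n' _ h1 h2 h0
      exact eq_of_coord h1 h2 h0
    · intro n hn n' hn'
      exact hcl n n' (Finset.mem_filter.1 hn).2 (Finset.mem_filter.1 hn').2 _
    · intro n hn n' hn'
      exact hcl n n' (Finset.mem_filter.1 hn).2 (Finset.mem_filter.1 hn').2 _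
    · intro n' hn' n hn h1 h2
      obtain ⟨hnA, hnl⟩ := Finset.mem_filter.1 hn
      obtain ⟨hnA', hnl'⟩ := Finset.mem_filter.1 hn'
      have hd := hcl n' n hnl' hnl i
      by_cases hDbig : 68 * N ≤ D
      · have hv := hdir hDbig n hnA
        rw [show dir n = i by simpa using congrArg (fun z => z.2.2) hnl] at hv
        obtain ⟨a1, a2, a3, a4⟩ := mem n hnA
        obtain ⟨b1, b2, b3, b4⟩ := mem n' hnA'
        exact abs_coord_sub_le_of_window hN hδ a1 b1 a2 b2 a3 a4 b3 b4 h1.symm h2.symm hd hv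
      · refine hd.trans ?_
        rw [hr, div_le_div_iff₀ (by norm_num) hδ]
        have : N * (N * δ * δ) ≤ N * 80 := by nlinarith
        have := le_of_mul_le_mul_left this hN0
        linarith
  have hcard := Finset.card_le_mul_card_image_of_maps_to hmaps _ hfib
  have hYc : Y.card = (⌊1 / δ⌋₊ + 1) * (529 ^ 3 * 3) := by
    simp [hY, Finset.card_product, Pi.card_Icc]
  rw [hYc] at hcard
  have hcard' : (A.card : ℝ) ≤ ((⌊22 / δ⌋₊ + 1) * (⌊r⌋₊ + 1) * (⌊r⌋₊ + 1)) *
      ((⌊1 / δ⌋₊ + 1) * (529 ^ 3 * 3)) := by exact_mod_cast hcard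
  refine hcard'.trans ?_
  have f1 : (⌊22 / δ⌋₊ : ℝ) + 1 ≤ 29 / δ := by
    have := Nat.floor_le (show 0 ≤ 22 / δ by positivity)
    have : 1 ≤ 7 / δ := by rwa [le_div_iff₀ hδ, one_mul]
    have : 29 / δ = 22 / δ + 7 / δ := by ring
    linarith
  have f2 : (⌊1 / δ⌋₊ : ℝ) + 1 ≤ 8 / δ := by
    have := Nat.floor_le (show 0 ≤ 1 / δ by positivity)
    have : 1 ≤ 7 / δ := by rwa [le_div_iff₀ hδ, one_mul]
    have : 8 / δ = 1 / δ + 7 / δ := by ring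
    linarith
  have f3 : (⌊r⌋₊ : ℝ) + 1 ≤ 2 * (N * δ) := by
    have := Nat.floor_le hr0.le
    linarith
  calc _ ≤ (29 / δ * (2 * (N * δ)) * (2 * (N * δ))) * (8 / δ * (529 ^ 3 * 3)) := by gcongr
    _ = 29 * 4 * 8 * 529 ^ 3 * 3 * N ^ 2 := by field_simp; ring
    _ ≤ _ := by gcongr; norm_num

theorem dotZ_add (n m : Fin 3 → ℤ) (x : Fin 3 → ℝ) : dotZ (n + m) x = dotZ n x + dotZ m x := by
  simp [dotZ, add_mul, Finset.sum_add_distrib]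

theorem dotZ_sub (n m : Fin 3 → ℤ) (x : Fin 3 → ℝ) : dotZ (n - m) x = dotZ n x - dotZ m x := by
  simp [dotZ, sub_mul, Finset.sum_sub_distrib]

theorem continuous_dotZ (n : Fin 3 → ℤ) : Continuous (dotZ n) := by
  unfold dotZ; fun_prop

theorem measurableSet_cube : MeasurableSet cube :=
  MeasurableSet.univ_pi fun _ => measurableSet_Ico

theorem integral_exp_int (k : ℤ) :
    ∫ x in Set.Ico (0 : ℝ) (2 * Real.pi), Complex.exp (Complex.I * ((k * x : ℝ) : ℂ)) =
      if k = 0 then ((2 * Real.pi : ℝ) : ℂ) else 0 := by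
  rw [setIntegral_congr_set Ico_ae_eq_Ioc,
    ← intervalIntegral.integral_of_le (by positivity)]
  split_ifs with hk
  · simp [hk]
  · have hc : Complex.I * k ≠ 0 := by simp [hk]
    have := integral_exp_mul_complex (a := 0) (b := 2 * Real.pi) hc
    simp only [mul_assoc, Complex.ofReal_mul, Complex.ofReal_intCast] at this ⊢
    rw [this]
    have e : Complex.exp (Complex.I * (k * ((2 : ℝ) * Real.pi))) = 1 := by
      rw [Complex.exp_eq_one_iff]
      exact ⟨k, by push_cast; ring⟩
    rw [e]
    simp

theorem volume_restrict_cube : (volume : Measure (Fin 3 → ℝ)).restrict cube =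
    Measure.pi fun _ : Fin 3 => volume.restrict (Set.Ico (0 : ℝ) (2 * Real.pi)) := by
  rw [cube, volume_pi, Measure.restrict_pi_pi]

theorem integral_cube_exp (k : Fin 3 → ℤ) :
    ∫ x in cube, Complex.exp (Complex.I * ((dotZ k x : ℝ) : ℂ)) =
      if k = 0 then (((2 * Real.pi) ^ 3 : ℝ) : ℂ) else 0 := by
  rw [volume_restrict_cube]
  have e : ∀ x : Fin 3 → ℝ, Complex.exp (Complex.I * ((dotZ k x : ℝ) : ℂ)) =
      ∏ i, Complex.exp (Complex.I * ((k i * x i : ℝ) : ℂ)) := fun x => by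
    rw [← Complex.exp_sum, dotZ, Complex.ofReal_sum, Finset.mul_sum]
  simp_rw [e]
  rw [integral_fintype_prod_eq_prod
    (f := fun i (x : ℝ) => Complex.exp (Complex.I * ((k i * x : ℝ) : ℂ)))]
  simp_rw [integral_exp_int]
  split_ifs with hk
  · simp [hk]
  · obtain ⟨i, hi⟩ := Function.ne_iff.1 hk
    exact Finset.prod_eq_zero (Finset.mem_univ i) (by simpa using hi)

theorem integrable_cube_exp (k : Fin 3 → ℤ) :
    Integrable (fun x => Complex.exp (Complex.I * ((dotZ k x : ℝ) : ℂ)))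
      ((volume : Measure (Fin 3 → ℝ)).restrict cube) := by
  have : IsFiniteMeasure ((volume : Measure (Fin 3 → ℝ)).restrict cube) := by
    rw [volume_restrict_cube]; infer_instance
  have hc := continuous_dotZ k
  refine (integrable_const (1 : ℝ)).mono' (by fun_prop : Continuous _).aestronglyMeasurable ?_
  filter_upwards with x
  rw [mul_comm, Complex.norm_exp_ofReal_mul_I]

theorem integral_gaussian_exp (ν : ℝ) :
    ∫ t : ℝ, ((Real.exp (-t ^ 2) : ℝ) : ℂ) * Complex.exp (Complex.I * ((ν * t : ℝ) : ℂ)) =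
      ((√Real.pi * Real.exp (-ν ^ 2 / 4) : ℝ) : ℂ) := by
  have h := fourierIntegral_gaussian (b := 1) (by simp) ν
  have e : ∀ t : ℝ, ((Real.exp (-t ^ 2) : ℝ) : ℂ) * Complex.exp (Complex.I * ((ν * t : ℝ) : ℂ)) =
      Complex.exp (Complex.I * ν * t) * Complex.exp (-1 * t ^ 2) := fun t => by
    push_cast
    rw [mul_comm]; ring_nf
  simp_rw [e, h]
  rw [Real.sqrt_eq_rpow, div_one, mul_one]
  push_cast
  rw [Complex.ofReal_cpow Real.pi_pos.le]
  push_cast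
  rfl

theorem integrable_gaussian_exp (ν : ℝ) :
    Integrable fun t : ℝ =>
      ((Real.exp (-t ^ 2) : ℝ) : ℂ) * Complex.exp (Complex.I * ((ν * t : ℝ) : ℂ)) := by
  have h := integrable_exp_neg_mul_sq (b := 1) one_pos
  refine h.mono' (by fun_prop : Continuous _).aestronglyMeasurable ?_
  filter_upwards with t
  rw [norm_mul, mul_comm Complex.I, Complex.norm_exp_ofReal_mul_I, mul_one, Complex.norm_real,
    Real.norm_of_nonneg (Real.exp_pos _).le, neg_one_mul]

/-- A finite exponential sum in space-time. -/
noncomputable def expSum {ι : Type*} (s : Finset ι) (k : ι → Fin 3 → ℤ) (ν : ι → ℝ) (b : ι → ℂ)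
    (p : ℝ × (Fin 3 → ℝ)) : ℂ :=
  ∑ j ∈ s, b j * Complex.exp (Complex.I * ((dotZ (k j) p.2 + ν j * p.1 : ℝ) : ℂ))

theorem continuous_expSum {ι : Type*} (s : Finset ι) (k : ι → Fin 3 → ℤ) (ν : ι → ℝ)
    (b : ι → ℂ) : Continuous (expSum s k ν b) := by
  unfold expSum
  have := continuous_dotZ
  fun_prop

theorem gaussian_mul_normSq_expSum {ι : Type*} (s : Finset ι) (k : ι → Fin 3 → ℤ) (ν : ι → ℝ)
    (b : ι → ℂ) (p : ℝ × (Fin 3 → ℝ)) :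
    ((Real.exp (-p.1 ^ 2) * ‖expSum s k ν b p‖ ^ 2 : ℝ) : ℂ) =
      ∑ i ∈ s, ∑ j ∈ s, b i * starRingEnd ℂ (b j) *
        ((((Real.exp (-p.1 ^ 2) : ℝ) : ℂ) *
            Complex.exp (Complex.I * (((ν i - ν j) * p.1 : ℝ) : ℂ))) *
          Complex.exp (Complex.I * ((dotZ (k i - k j) p.2 : ℝ) : ℂ))) := by
  have h : ((‖expSum s k ν b p‖ ^ 2 : ℝ) : ℂ) =
      expSum s k ν b p * starRingEnd ℂ (expSum s k ν b p) := by
    rw [Complex.mul_conj, Complex.normSq_eq_norm_sq]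
  rw [Complex.ofReal_mul, h, expSum, map_sum, Finset.sum_mul_sum, Finset.mul_sum]
  refine Finset.sum_congr rfl fun i _ => ?_
  rw [Finset.mul_sum]
  refine Finset.sum_congr rfl fun j _ => ?_
  have e : Complex.exp (Complex.I * (((ν i - ν j) * p.1 : ℝ) : ℂ)) *
      Complex.exp (Complex.I * ((dotZ (k i - k j) p.2 : ℝ) : ℂ)) =
      Complex.exp (Complex.I * ((dotZ (k i) p.2 + ν i * p.1 : ℝ) : ℂ)) *
        starRingEnd ℂ (Complex.exp (Complex.I * ((dotZ (k j) p.2 + ν j * p.1 : ℝ) : ℂ))) := by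
    rw [← Complex.exp_conj, ← Complex.exp_add, ← Complex.exp_add, dotZ_sub]
    congr 1
    simp only [map_mul, Complex.conj_I, Complex.conj_ofReal]
    push_cast
    ring
  rw [mul_assoc (((Real.exp (-p.1 ^ 2) : ℝ) : ℂ)), e, map_mul]
  ring

theorem sum_mul_mul_kernel_le {ι : Type*} (s : Finset ι) (b : ι → ℝ) (K : ι → ι → ℝ)
    (hK : ∀ i j, 0 ≤ K i j) (hsymm : ∀ i j, K i j = K j i) {M : ℝ}
    (hM : ∀ i ∈ s, ∑ j ∈ s, K i j ≤ M) :
    ∑ i ∈ s, ∑ j ∈ s, b i * b j * K i j ≤ M * ∑ i ∈ s, b i ^ 2 := by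
  have h1 : ∑ i ∈ s, ∑ j ∈ s, b i * b j * K i j ≤
      ∑ i ∈ s, ∑ j ∈ s, (b i ^ 2 / 2 * K i j + b j ^ 2 / 2 * K j i) := by
    gcongr with i _ j _
    rw [hsymm j i, ← add_mul]
    have := hK i j
    gcongr
    nlinarith [sq_nonneg (b i - b j)]
  refine h1.trans ?_
  simp_rw [Finset.sum_add_distrib]
  rw [Finset.sum_comm (f := fun i j => b j ^ 2 / 2 * K j i)]
  simp_rw [← Finset.mul_sum, ← Finset.sum_add_distrib, ← add_mul, add_halves]
  rw [Finset.mul_sum]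
  refine Finset.sum_le_sum fun i hi => ?_
  rw [mul_comm]
  exact mul_le_mul_of_nonneg_right (hM i hi) (sq_nonneg _)

theorem integrable_gaussian_mul_normSq_expSum {ι : Type*} (s : Finset ι) (k : ι → Fin 3 → ℤ)
    (ν : ι → ℝ) (b : ι → ℂ) :
    Integrable (fun p : ℝ × (Fin 3 → ℝ) => Real.exp (-p.1 ^ 2) * ‖expSum s k ν b p‖ ^ 2)
      ((volume : Measure ℝ).prod (volume.restrict cube)) := by
  suffices h : Integrable (fun p : ℝ × (Fin 3 → ℝ) =>
      ((Real.exp (-p.1 ^ 2) * ‖expSum s k ν b p‖ ^ 2 : ℝ) : ℂ))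
      ((volume : Measure ℝ).prod (volume.restrict cube)) from h.re
  refine Integrable.congr ?_ (ae_of_all _ fun p => (gaussian_mul_normSq_expSum s k ν b p).symm)
  refine integrable_finsetSum _ fun i _ => integrable_finsetSum _ fun j _ => ?_
  exact ((integrable_gaussian_exp (ν i - ν j)).mul_prod
    (integrable_cube_exp (k i - k j))).const_mul _

theorem integral_gaussian_mul_normSq_expSum_le {ι : Type*} (s : Finset ι)
    (k : ι → Fin 3 → ℤ) (ν : ι → ℝ) (b : ι → ℂ) {M : ℝ}
    (hM : ∀ i ∈ s, ∑ j ∈ s, (if k j = k i then Real.exp (-(ν i - ν j) ^ 2 / 4) else 0) ≤ M) :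
    ∫ p, Real.exp (-p.1 ^ 2) * ‖expSum s k ν b p‖ ^ 2
        ∂((volume : Measure ℝ).prod (volume.restrict cube)) ≤
      √Real.pi * (2 * Real.pi) ^ 3 * (M * ∑ i ∈ s, ‖b i‖ ^ 2) := by
  have hcross : ∀ i j, Integrable (fun p : ℝ × (Fin 3 → ℝ) => b i * starRingEnd ℂ (b j) *
        ((((Real.exp (-p.1 ^ 2) : ℝ) : ℂ) *
            Complex.exp (Complex.I * (((ν i - ν j) * p.1 : ℝ) : ℂ))) *
          Complex.exp (Complex.I * ((dotZ (k i - k j) p.2 : ℝ) : ℂ))))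
      ((volume : Measure ℝ).prod (volume.restrict cube)) := fun i j =>
    ((integrable_gaussian_exp (ν i - ν j)).mul_prod (integrable_cube_exp (k i - k j))).const_mul _
  have hval : ((∫ p, Real.exp (-p.1 ^ 2) * ‖expSum s k ν b p‖ ^ 2
        ∂((volume : Measure ℝ).prod (volume.restrict cube)) : ℝ) : ℂ) =
      ∑ i ∈ s, ∑ j ∈ s, b i * starRingEnd ℂ (b j) *
        (((√Real.pi * Real.exp (-(ν i - ν j) ^ 2 / 4) : ℝ) : ℂ) *
          if k i - k j = 0 then (((2 * Real.pi) ^ 3 : ℝ) : ℂ) else 0) := by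
    rw [← integral_complex_ofReal]
    simp_rw [gaussian_mul_normSq_expSum]
    rw [integral_finsetSum _ fun i _ => integrable_finsetSum _ fun j _ => hcross i j]
    refine Finset.sum_congr rfl fun i _ => ?_
    rw [integral_finsetSum _ fun j _ => hcross i j]
    refine Finset.sum_congr rfl fun j _ => ?_
    rw [integral_const_mul,
      integral_prod_mul (μ := (volume : Measure ℝ)) (ν := volume.restrict cube)
        (fun t : ℝ => ((Real.exp (-t ^ 2) : ℝ) : ℂ) *
          Complex.exp (Complex.I * (((ν i - ν j) * t : ℝ) : ℂ)))
        (fun x => Complex.exp (Complex.I * ((dotZ (k i - k j) x : ℝ) : ℂ))),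
      integral_gaussian_exp, integral_cube_exp]
  set K : ι → ι → ℝ := fun i j => if k j = k i then Real.exp (-(ν i - ν j) ^ 2 / 4) else 0 with hK
  have hsymm : ∀ i j, K i j = K j i := fun i j => by
    simp only [hK, eq_comm (a := k j)]
    rw [show (ν i - ν j) ^ 2 = (ν j - ν i) ^ 2 by ring]
  have hpos : ∀ i j, 0 ≤ K i j := fun i j => by
    simp only [hK]; split_ifs <;> positivity
  have hnorm := congrArg norm hval
  rw [Complex.norm_real] at hnorm
  refine (Real.le_norm_self _).trans (hnorm.trans_le ?_)
  refine (norm_sum_le _ _).trans ((Finset.sum_le_sum fun i _ => norm_sum_le _ _).trans ?_)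
  have := sum_mul_mul_kernel_le s (fun i => ‖b i‖) K hpos hsymm hM
  refine le_trans (le_of_eq ?_) (mul_le_mul_of_nonneg_left this
    (by positivity : 0 ≤ √Real.pi * (2 * Real.pi) ^ 3))
  rw [Finset.mul_sum]
  refine Finset.sum_congr rfl fun i _ => ?_
  rw [Finset.mul_sum]
  refine Finset.sum_congr rfl fun j _ => ?_
  simp only [hK, sub_eq_zero, norm_mul, RCLike.norm_conj, Complex.norm_real, eq_comm (a := k i)]
  split_ifs
  · rw [Complex.norm_real, Real.norm_of_nonneg (by positivity),
      Real.norm_of_nonneg (by positivity : 0 ≤ (2 * Real.pi) ^ 3)]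
    simp only [Real.norm_eq_abs, abs_of_pos (Real.exp_pos _)]
    ring
  · simp

theorem lintegral_normSq_expSum_le {ι : Type*} (s : Finset ι)
    (k : ι → Fin 3 → ℤ) (ν : ι → ℝ) (b : ι → ℂ) {T M : ℝ} (hT : 0 ≤ T)
    (hM : ∀ i ∈ s, ∑ j ∈ s, (if k j = k i then Real.exp (-(ν i - ν j) ^ 2 / 4) else 0) ≤ M) :
    ∫⁻ p in Set.Icc 0 T ×ˢ cube, ‖expSum s k ν b p‖ₑ ^ 2 ≤
      ENNReal.ofReal (Real.exp (T ^ 2) * (√Real.pi * (2 * Real.pi) ^ 3) *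
        (M * ∑ i ∈ s, ‖b i‖ ^ 2)) := by
  have hmeas : MeasurableSet (Set.Icc 0 T ×ˢ cube) := measurableSet_Icc.prod measurableSet_cube
  have h1 : ∫⁻ p in Set.Icc 0 T ×ˢ cube, ‖expSum s k ν b p‖ₑ ^ 2 ≤
      ∫⁻ p in Set.Icc 0 T ×ˢ cube, ENNReal.ofReal (Real.exp (T ^ 2) *
        (Real.exp (-p.1 ^ 2) * ‖expSum s k ν b p‖ ^ 2)) := by
    refine setLIntegral_mono' hmeas fun p hp => ?_
    obtain ⟨h0, h1⟩ := hp.1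
    rw [← ofReal_norm, ← ENNReal.ofReal_pow (norm_nonneg _)]
    apply ENNReal.ofReal_le_ofReal
    rw [← mul_assoc, ← Real.exp_add]
    refine le_mul_of_one_le_left (by positivity) (Real.one_le_exp ?_)
    nlinarith
  refine h1.trans ((lintegral_mono_set (Set.prod_mono_left (Set.subset_univ _))).trans ?_)
  rw [Measure.volume_eq_prod, ← Measure.prod_restrict, Measure.restrict_univ,
    ← ofReal_integral_eq_lintegral_ofReal
      ((integrable_gaussian_mul_normSq_expSum s k ν b).const_mul _)
      (ae_of_all _ fun p => by positivity), integral_const_mul, mul_assoc]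
  apply ENNReal.ofReal_le_ofReal
  gcongr
  exact integral_gaussian_mul_normSq_expSum_le s k ν b hM

theorem exists_summable_gaussian_majorant : ∃ w : ℤ → ℝ, Summable w ∧ (∀ k, 0 ≤ w k) ∧
    ∀ x : ℝ, Real.exp (-x ^ 2 / 4) ≤ w ⌊x⌋ := by
  refine ⟨fun k => 8 * (1 / (k : ℝ) ^ 2) + if k = 0 then 8 else 0, ?_, fun k => ?_, fun x => ?_⟩
  · exact ((Real.summable_one_div_int_pow.2 one_lt_two).mul_left 8).add
      (hasSum_ite_eq (0 : ℤ) (8 : ℝ)).summable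
  · dsimp only
    split_ifs <;> positivity
  · have h1 : Real.exp (-x ^ 2 / 4) ≤ 4 / (4 + x ^ 2) := by
      rw [neg_div, Real.exp_neg, inv_eq_one_div, div_le_div_iff₀ (Real.exp_pos _) (by positivity)]
      linarith [Real.add_one_le_exp (x ^ 2 / 4)]
    refine h1.trans ?_
    by_cases hk : ⌊x⌋ = 0
    · simp only [hk, if_true]
      rw [div_le_iff₀ (by positivity)]
      simp
      nlinarith [sq_nonneg x]
    · have hk2 : 0 < (⌊x⌋ : ℝ) ^ 2 := by positivity
      simp only [hk, if_false, add_zero]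
      rw [mul_one_div, div_le_div_iff₀ (by positivity) hk2]
      have f1 := Int.floor_le x
      have f2 := Int.lt_floor_add_one x
      nlinarith [sq_nonneg (2 * x - ⌊x⌋)]

theorem exists_gaussian_sum_bound : ∃ W > 0, ∀ {α : Type} (A : Finset α) (g : α → ℝ) (M : ℝ),
    (∀ τ, ((A.filter fun m => τ ≤ g m ∧ g m < τ + 1).card : ℝ) ≤ M) →
    ∀ x, ∑ m ∈ A, Real.exp (-(x - g m) ^ 2 / 4) ≤ W * M := by
  obtain ⟨w, hw, hw0, hexp⟩ := exists_summable_gaussian_majorant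
  refine ⟨∑' k, w k + 1, add_pos_of_nonneg_of_pos (tsum_nonneg hw0) one_pos,
    fun A g M hM x => ?_⟩
  have hM0 : 0 ≤ M := (Nat.cast_nonneg _).trans (hM 0)
  calc ∑ m ∈ A, Real.exp (-(x - g m) ^ 2 / 4) ≤ ∑ m ∈ A, w ⌊g m - x⌋ := by
        refine Finset.sum_le_sum fun m _ => ?_
        rw [show (x - g m) ^ 2 = (g m - x) ^ 2 by ring]
        exact hexp _
    _ = ∑ k ∈ A.image fun m => ⌊g m - x⌋, (A.filter fun m => ⌊g m - x⌋ = k).card • w k :=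
        Finset.sum_comp w fun m => ⌊g m - x⌋
    _ ≤ ∑ k ∈ A.image fun m => ⌊g m - x⌋, w k * M := by
        refine Finset.sum_le_sum fun k _ => ?_
        rw [nsmul_eq_mul, mul_comm]
        refine mul_le_mul_of_nonneg_left (le_trans ?_ (hM (x + k))) (hw0 k)
        refine Nat.cast_le.2 (Finset.card_le_card fun m hm => ?_)
        rw [Finset.mem_filter] at hm ⊢
        obtain ⟨h1, h2⟩ := Int.floor_eq_iff.1 hm.2
        exact ⟨hm.1, by linarith, by linarith⟩
    _ ≤ (∑' k, w k) * M := by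
        rw [← Finset.sum_mul]
        exact mul_le_mul_of_nonneg_right (hw.sum_le_tsum _ fun k _ => hw0 k) hM0
    _ ≤ _ := by gcongr; simp

/-- The value at the space-time point `p` of the free wave with coefficient vector `v`. -/
noncomputable def waveEval (S : Finset (Fin 3 → ℤ)) (σ : ℝ) (p : ℝ × (Fin 3 → ℝ)) :
    EuclideanSpace ℂ ↥S →ₗ[ℂ] ℂ where
  toFun v := expSum Finset.univ (fun n : ↥S => n.1) (fun n => σ * jbZ n.1) (fun n => v n) p
  map_add' v w := by simp [expSum, add_mul, Finset.sum_add_distrib]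
  map_smul' a v := by simp [expSum, mul_assoc, Finset.mul_sum]

theorem waveEval_apply (S : Finset (Fin 3 → ℤ)) (σ : ℝ) (p : ℝ × (Fin 3 → ℝ))
    (v : EuclideanSpace ℂ ↥S) : waveEval S σ p v =
      expSum Finset.univ (fun n : ↥S => n.1) (fun n => σ * jbZ n.1) (fun n => v n) p := rfl

theorem continuous_waveEval (S : Finset (Fin 3 → ℤ)) (σ : ℝ) (v : EuclideanSpace ℂ ↥S) :
    Continuous fun p => waveEval S σ p v :=
  continuous_expSum _ _ _ _

theorem freqLocFun_eq_waveEval (S : Finset (Fin 3 → ℤ)) (σ : ℝ) (c : (Fin 3 → ℤ) → ℝ → ℂ)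
    (p : ℝ × (Fin 3 → ℝ)) :
    freqLocFun S c p.1 p.2 = waveEval S σ p (modCurve S σ c p.1) := by
  rw [waveEval_apply, freqLocFun, expSum, ← Finset.sum_coe_sort]
  refine Finset.sum_congr rfl fun n _ => ?_
  simp only [modCurve, WithLp.equiv_symm_apply]
  rw [mul_right_comm, ← Complex.exp_add, mul_comm]
  congr 2
  push_cast
  ring

theorem lintegral_waveEval_sq_le {T : ℝ} (hT : 0 ≤ T) (S : Finset (Fin 3 → ℤ)) (σ : ℝ)
    (v : EuclideanSpace ℂ ↥S) :
    ∫⁻ p in Set.Icc 0 T ×ˢ cube, ‖waveEval S σ p v‖ₑ ^ 2 ≤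
      ENNReal.ofReal (Real.exp (T ^ 2) * (√Real.pi * (2 * Real.pi) ^ 3) * ‖v‖ ^ 2) := by
  have := lintegral_normSq_expSum_le Finset.univ (fun n : ↥S => n.1) (fun n => σ * jbZ n.1)
    (fun n => v n) (M := 1) hT (fun i _ => by
      simp only [Subtype.coe_inj, Finset.sum_ite_eq', Finset.mem_univ, if_true, sub_self]
      norm_num)
  rwa [one_mul, ← EuclideanSpace.norm_sq_eq] at this

theorem expSum_sq {ι : Type*} [Fintype ι] (k : ι → Fin 3 → ℤ) (ν : ι → ℝ) (b : ι → ℂ)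
    (p : ℝ × (Fin 3 → ℝ)) :
    expSum Finset.univ k ν b p ^ 2 =
      expSum Finset.univ (fun P : ι × ι => k P.1 + k P.2) (fun P => ν P.1 + ν P.2)
        (fun P => b P.1 * b P.2) p := by
  rw [expSum, expSum, sq, Finset.sum_mul_sum, Fintype.sum_prod_type]
  refine Finset.sum_congr rfl fun i _ => Finset.sum_congr rfl fun j _ => ?_
  rw [mul_mul_mul_comm, ← Complex.exp_add, dotZ_add]
  congr 2
  push_cast
  ring

theorem exists_pair_kernel_bound : ∃ W > 0, ∀ N : ℝ, 1 ≤ N → ∀ σ : ℝ, (σ = 1 ∨ σ = -1) →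
    ∀ P : ↥(annulus N) × ↥(annulus N), ∑ Q : ↥(annulus N) × ↥(annulus N),
      (if Q.1.1 + Q.2.1 = P.1.1 + P.2.1 then
        Real.exp (-((σ * jbZ P.1.1 + σ * jbZ P.2.1) - (σ * jbZ Q.1.1 + σ * jbZ Q.2.1)) ^ 2 / 4)
        else 0) ≤ W * N ^ 2 := by
  obtain ⟨W, hW, hsum⟩ := exists_gaussian_sum_bound
  refine ⟨W * 10 ^ 12, by positivity, fun N hN σ hσ P => ?_⟩
  set ξ := P.1.1 + P.2.1
  rw [← Finset.sum_filter, mul_assoc]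
  refine le_trans (le_of_eq ?_) (hsum (Finset.univ.filter
    fun Q : ↥(annulus N) × ↥(annulus N) => Q.1.1 + Q.2.1 = ξ)
    (fun Q => jbZ Q.1.1 + jbZ Q.2.1) _ (fun τ => ?_) (jbZ P.1.1 + jbZ P.2.1))
  · refine Finset.sum_congr rfl fun Q _ => ?_
    rw [← mul_add, ← mul_add, ← mul_sub, mul_pow,
      show σ ^ 2 = 1 by rcases hσ with rfl | rfl <;> norm_num, one_mul]
  · refine le_trans (Nat.cast_le.2 (Finset.card_le_card_of_injOn (fun Q => Q.1.1) ?_ ?_))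
      (card_phase_window_le hN ξ τ)
    · intro Q hQ
      simp only [Finset.coe_filter, Finset.mem_filter, Finset.mem_univ, true_and,
        Set.mem_ofPred_eq] at hQ ⊢
      have e : ξ - Q.1.1 = Q.2.1 := by rw [← hQ.1]; abel
      rw [e]
      exact ⟨Q.1.2, Q.2.2, hQ.2⟩
    · intro Q hQ R hR h
      simp only [Finset.coe_filter, Finset.mem_filter, Finset.mem_univ, true_and,
        Set.mem_ofPred_eq] at hQ hR h
      have h2 : Q.2.1 = R.2.1 := by
        have := hQ.1.trans hR.1.symm
        rw [h] at this
        exact add_left_cancel this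
      exact Prod.ext (Subtype.ext h) (Subtype.ext h2)

theorem exists_lintegral_waveEval_pow_four_le {T : ℝ} (hT : 0 ≤ T) : ∃ B > 0, ∀ N : ℝ, 1 ≤ N →
    ∀ σ : ℝ, (σ = 1 ∨ σ = -1) → ∀ v : EuclideanSpace ℂ ↥(annulus N),
    ∫⁻ p in Set.Icc 0 T ×ˢ cube, ‖waveEval (annulus N) σ p v‖ₑ ^ 4 ≤
      ENNReal.ofReal (B * N ^ 2 * ‖v‖ ^ 4) := by
  obtain ⟨W, hW, hker⟩ := exists_pair_kernel_bound
  refine ⟨Real.exp (T ^ 2) * (√Real.pi * (2 * Real.pi) ^ 3) * W, by positivity,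
    fun N hN σ hσ v => ?_⟩
  have := lintegral_normSq_expSum_le Finset.univ
    (fun P : ↥(annulus N) × ↥(annulus N) => P.1.1 + P.2.1)
    (fun P => σ * jbZ P.1.1 + σ * jbZ P.2.1) (fun P => v P.1 * v P.2) hT
    (fun P _ => hker N hN σ hσ P)
  simp_rw [← expSum_sq (fun n : ↥(annulus N) => n.1) (fun n => σ * jbZ n.1) (fun n => v n),
    enorm_pow, ← pow_mul] at this
  refine this.trans (le_of_eq ?_)
  congr 1
  have e : ∑ P : ↥(annulus N) × ↥(annulus N), ‖v P.1 * v P.2‖ ^ 2 = ‖v‖ ^ 4 := by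
    simp_rw [norm_mul, mul_pow]
    rw [Fintype.sum_prod_type]
    dsimp only
    rw [← Finset.sum_mul_sum, ← EuclideanSpace.norm_sq_eq]
    ring
  rw [e]
  ring

theorem exists_lintegral_waveEval_rpow_le {T q : ℝ} (hT : 0 ≤ T) (hq2 : 2 ≤ q) (hq4 : q ≤ 4) :
    ∃ C > 0, ∀ N : ℝ, 1 ≤ N → ∀ σ : ℝ, (σ = 1 ∨ σ = -1) →
    ∀ v : EuclideanSpace ℂ ↥(annulus N),
    ∫⁻ p in Set.Icc 0 T ×ˢ cube, ‖waveEval (annulus N) σ p v‖ₑ ^ q ≤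
      ENNReal.ofReal (C * N ^ (q - 2) * ‖v‖ ^ q) := by
  obtain ⟨B, hB, hfour⟩ := exists_lintegral_waveEval_pow_four_le hT
  obtain ⟨A, hA, hA'⟩ : ∃ A > 0, A = Real.exp (T ^ 2) * (√Real.pi * (2 * Real.pi) ^ 3) :=
    ⟨_, by positivity, rfl⟩
  have hα : 0 ≤ (4 - q) / 2 := by linarith
  have hβ : 0 ≤ (q - 2) / 2 := by linarith
  refine ⟨A ^ ((4 - q) / 2) * B ^ ((q - 2) / 2), by positivity, fun N hN σ hσ v => ?_⟩
  have hc := (continuous_waveEval (annulus N) σ v).enorm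
  have hpow : ∀ p, ‖waveEval (annulus N) σ p v‖ₑ ^ q =
      (‖waveEval (annulus N) σ p v‖ₑ ^ 2) ^ ((4 - q) / 2) *
        (‖waveEval (annulus N) σ p v‖ₑ ^ 4) ^ ((q - 2) / 2) := fun p => by
    rw [← ENNReal.rpow_natCast, ← ENNReal.rpow_natCast, ← ENNReal.rpow_mul, ← ENNReal.rpow_mul,
      ← ENNReal.rpow_add_of_nonneg _ _ (by positivity) (by positivity)]
    congr 1
    push_cast
    ring
  simp_rw [hpow]
  refine (ENNReal.lintegral_mul_norm_pow_le (hc.measurable.pow_const 2).aemeasurable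
    (hc.measurable.pow_const 4).aemeasurable hα hβ (by ring)).trans ?_
  refine (mul_le_mul' (ENNReal.rpow_le_rpow (lintegral_waveEval_sq_le hT _ σ v) hα)
    (ENNReal.rpow_le_rpow (hfour N hN σ hσ v) hβ)).trans (le_of_eq ?_)
  have hN0 : 0 ≤ N := by linarith
  rw [← hA', ENNReal.ofReal_rpow_of_nonneg (by positivity) hα,
    ENNReal.ofReal_rpow_of_nonneg (by positivity) hβ, ← ENNReal.ofReal_mul (by positivity)]
  congr 1
  rw [Real.mul_rpow hA.le (by positivity), Real.mul_rpow (by positivity) (by positivity),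
    Real.mul_rpow hB.le (by positivity)]
  have e1 : (N ^ 2) ^ ((q - 2) / 2) = N ^ (q - 2) := by
    rw [← Real.rpow_natCast, ← Real.rpow_mul hN0]; congr 1; push_cast; ring
  have e2 : (‖v‖ ^ 2) ^ ((4 - q) / 2) * (‖v‖ ^ 4) ^ ((q - 2) / 2) = ‖v‖ ^ q := by
    rw [← Real.rpow_natCast, ← Real.rpow_natCast, ← Real.rpow_mul (norm_nonneg _),
      ← Real.rpow_mul (norm_nonneg _),
      ← Real.rpow_add_of_nonneg (norm_nonneg _) (by positivity) (by positivity)]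
    congr 1
    push_cast
    ring
  rw [e1, ← e2]
  ring

theorem measurableSet_atom_interval (t₁ t₂ : EReal) :
    MeasurableSet {s : ℝ | t₁ ≤ (s : EReal) ∧ (s : EReal) < t₂} :=
  measurable_coe_real_ereal measurableSet_Ico

theorem IsUpAtom.measurable_waveEval {q : ℝ} {S : Finset (Fin 3 → ℤ)} {σ : ℝ}
    {a : ℝ → EuclideanSpace ℂ ↥S} (ha : IsUpAtom q a) :
    Measurable fun p : ℝ × (Fin 3 → ℝ) => waveEval S σ p (a p.1) := by
  obtain ⟨K, t, φ, -, -, -, h⟩ := ha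
  simp_rw [h, map_sum, apply_ite (waveEval S σ _), map_zero]
  refine Finset.measurable_sum _ fun k _ => Measurable.ite ?_
    (continuous_waveEval S σ (φ k)).measurable measurable_const
  exact measurable_fst (measurableSet_atom_interval _ _)

theorem IsUpAtom.enorm_waveEval_rpow_le {q : ℝ} (hq : 0 < q) {S : Finset (Fin 3 → ℤ)} {σ : ℝ}
    {a : ℝ → EuclideanSpace ℂ ↥S} {K : ℕ} {t : Fin (K + 1) → EReal}
    {φ : Fin K → EuclideanSpace ℂ ↥S} (ht : StrictMono t)
    (ha : ∀ s : ℝ, a s =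
      ∑ k : Fin K, if t k.castSucc ≤ (s : EReal) ∧ (s : EReal) < t k.succ then φ k else 0)
    (p : ℝ × (Fin 3 → ℝ)) :
    ‖waveEval S σ p (a p.1)‖ₑ ^ q ≤ ∑ k, ‖waveEval S σ p (φ k)‖ₑ ^ q := by
  by_cases hex : ∃ k : Fin K, t k.castSucc ≤ (p.1 : EReal) ∧ (p.1 : EReal) < t k.succ
  · obtain ⟨k, hk⟩ := hex
    have : a p.1 = φ k := by
      rw [ha, Finset.sum_eq_single k _ (by simp), if_pos hk]
      intro l _ hlk
      apply if_neg
      rintro ⟨h1, h2⟩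
      rcases lt_or_gt_of_ne hlk with h | h
      · exact absurd (hk.1.trans_lt h2) (not_lt.2 (ht.monotone (Fin.succ_le_castSucc_iff.2 h)))
      · exact absurd (h1.trans_lt hk.2) (not_lt.2 (ht.monotone (Fin.succ_le_castSucc_iff.2 h)))
    rw [this]
    exact Finset.single_le_sum (f := fun k => ‖waveEval S σ p (φ k)‖ₑ ^ q)
      (fun _ _ => zero_le) (Finset.mem_univ k)
  · push Not at hex
    have : a p.1 = 0 := by
      rw [ha]
      exact Finset.sum_eq_zero fun k _ => if_neg fun h => absurd h.2 (not_lt.2 (hex k h.1))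
    rw [this, map_zero, enorm_zero, ENNReal.zero_rpow_of_pos hq]
    exact zero_le

theorem exists_eLpNorm_atom_le {T q : ℝ} (hT : 0 ≤ T) (hq2 : 2 ≤ q) (hq4 : q ≤ 4) :
    ∃ C > 0, ∀ N : ℝ, 1 ≤ N → ∀ σ : ℝ, (σ = 1 ∨ σ = -1) →
    ∀ a : ℝ → EuclideanSpace ℂ ↥(annulus N), IsUpAtom q a →
    eLpNorm (fun p : ℝ × (Fin 3 → ℝ) => waveEval (annulus N) σ p (a p.1)) (ENNReal.ofReal q)
      (volume.restrict (Set.Icc 0 T ×ˢ cube)) ≤ ENNReal.ofReal (C * N ^ ((q - 2) / q)) := by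
  obtain ⟨C, hC, hfree⟩ := exists_lintegral_waveEval_rpow_le hT hq2 hq4
  have hq : 0 < q := by linarith
  refine ⟨C ^ (1 / q), by positivity, fun N hN σ hσ a ⟨K, t, φ, ht, _, hφ, ha⟩ => ?_⟩
  have hN0 : 0 ≤ N := by linarith
  have key : ∫⁻ p in Set.Icc 0 T ×ˢ cube, ‖waveEval (annulus N) σ p (a p.1)‖ₑ ^ q ≤
      ENNReal.ofReal (C * N ^ (q - 2)) :=
    calc _ ≤ ∫⁻ p in Set.Icc 0 T ×ˢ cube, ∑ k, ‖waveEval (annulus N) σ p (φ k)‖ₑ ^ q :=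
          lintegral_mono fun p => IsUpAtom.enorm_waveEval_rpow_le hq ht ha p
      _ = ∑ k, ∫⁻ p in Set.Icc 0 T ×ˢ cube, ‖waveEval (annulus N) σ p (φ k)‖ₑ ^ q :=
          lintegral_finsetSum _ fun k _ =>
            (continuous_waveEval _ σ (φ k)).enorm.measurable.pow_const q
      _ ≤ ∑ k, ENNReal.ofReal (C * N ^ (q - 2) * ‖φ k‖ ^ q) :=
          Finset.sum_le_sum fun k _ => hfree N hN σ hσ (φ k)
      _ = _ := by
          rw [← ENNReal.ofReal_sum_of_nonneg (fun k _ => by positivity), ← Finset.mul_sum, hφ,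
            mul_one]
  rw [eLpNorm_eq_lintegral_rpow_enorm_toReal (by simpa using hq) ENNReal.ofReal_ne_top,
    ENNReal.toReal_ofReal hq.le]
  refine (ENNReal.rpow_le_rpow key (by positivity)).trans (le_of_eq ?_)
  rw [ENNReal.ofReal_rpow_of_nonneg (by positivity) (by positivity),
    Real.mul_rpow hC.le (by positivity), ← Real.rpow_mul hN0, mul_one_div]

theorem eLpNorm_hasSum_smul_le {α : Type*} [MeasurableSpace α] {μ : Measure α} {p K : ℝ≥0∞}
    (hp : 1 ≤ p) {f : ℕ → α → ℂ} {g : α → ℂ} {lam : ℕ → ℂ} (hf : ∀ j, Measurable (f j))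
    (hK : ∀ j, eLpNorm (f j) p μ ≤ K) (hlam : Summable fun j => ‖lam j‖)
    (hg : ∀ x, HasSum (fun j => lam j * f j x) (g x)) :
    eLpNorm g p μ ≤ K * ENNReal.ofReal (∑' j, ‖lam j‖) := by
  have hmeas : ∀ j, AEStronglyMeasurable (lam j • f j) μ := fun j =>
    ((hf j).const_smul (lam j)).aestronglyMeasurable
  refine (Lp.eLpNorm_lim_le_liminf_eLpNorm
    (f := fun n => ∑ j ∈ Finset.range n, lam j • f j)
    (fun n => Finset.aestronglyMeasurable_sum _ fun j _ => hmeas j) g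
    (ae_of_all _ fun x => ?_)).trans ?_
  · simpa using (hg x).tendsto_sum_nat
  · refine liminf_le_of_frequently_le' (Frequently.of_forall fun n => ?_)
    calc eLpNorm (∑ j ∈ Finset.range n, lam j • f j) p μ
        ≤ ∑ j ∈ Finset.range n, eLpNorm (lam j • f j) p μ :=
          eLpNorm_sum_le (fun j _ => hmeas j) hp
      _ ≤ ∑ j ∈ Finset.range n, ENNReal.ofReal ‖lam j‖ * K := by
          refine Finset.sum_le_sum fun j _ => ?_
          rw [eLpNorm_const_smul, ofReal_norm]
          exact mul_le_mul_right (hK j) _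
      _ = K * ENNReal.ofReal (∑ j ∈ Finset.range n, ‖lam j‖) := by
          rw [← Finset.sum_mul, ENNReal.ofReal_sum_of_nonneg (fun j _ => norm_nonneg _), mul_comm]
      _ ≤ _ := by
          gcongr
          exact hlam.sum_le_tsum _ fun j _ => norm_nonneg _

/-- **L^q Strichartz estimate in adapted atomic spaces** (Corollary 5.4 (i) and (iii)).
For every `T > 0` and every `2 ≤ q ≤ 4` there exists `C(T,q) > 0` such that for every
`N ≥ 1`, every sign `σ ∈ {+1, -1}` and every frequency-localized space-time function
`u_N` at scale `N`,
`‖u_N‖_{L^q([0,T]×T³)} ≤ C(T,q) N^{(q-2)/q} ‖u_N‖_{U^q_σ}`. -/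
theorem Lq_strichartz_adapted (T : ℝ) (hT : 0 < T) (q : ℝ) (hq2 : 2 ≤ q) (hq4 : q ≤ 4) :
    ∃ C > (0:ℝ), ∀ N : ℝ, 1 ≤ N → ∀ σ : ℝ, (σ = 1 ∨ σ = -1) →
      ∀ c : (Fin 3 → ℤ) → ℝ → ℂ, (∀ n, Measurable (c n)) →
      eLpNorm (fun p : ℝ × (Fin 3 → ℝ) => freqLocFun (annulus N) c p.1 p.2)
          (ENNReal.ofReal q) (volume.restrict (Set.Icc 0 T ×ˢ cube)) ≤
        ENNReal.ofReal (C * N ^ ((q - 2) / q)) * UpNorm q (modCurve (annulus N) σ c) := by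
  obtain ⟨C, hC, hatom⟩ := exists_eLpNorm_atom_le hT.le hq2 hq4
  refine ⟨C, hC, fun N hN σ hσ c _ => ?_⟩
  have hK : 0 < C * N ^ ((q - 2) / q) := by
    have : 0 < N := by linarith
    positivity
  rw [mul_comm, ← ENNReal.div_le_iff_le_mul (Or.inl (by simpa using hK))
    (Or.inl ENNReal.ofReal_ne_top)]
  refine le_sInf ?_
  rintro M ⟨lam, a, ha, hlam, hsum, rfl⟩
  rw [ENNReal.div_le_iff_le_mul (Or.inl (by simpa using hK)) (Or.inl ENNReal.ofReal_ne_top),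
    mul_comm]
  simp_rw [freqLocFun_eq_waveEval (annulus N) σ c]
  refine eLpNorm_hasSum_smul_le (f := fun j p => waveEval (annulus N) σ p (a j p.1))
    (by rw [ENNReal.one_le_ofReal]; linarith) (fun j => (ha j).measurable_waveEval)
    (fun j => hatom N hN σ hσ (a j) (ha j)) hlam fun p => ?_
  have := (hsum p.1).map (waveEval (annulus N) σ p)
    (LinearMap.continuous_of_finiteDimensional _)
  simpa [Function.comp_def] using this
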